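/- (A non-injective FBI operator) Define V : ℓ²(ℕ) → ℓ²(ℕ) on the canonical basis by V e₁ = Σ_j c_j e_j and V e_i = e_{i−1} for i ≥ 2, where (c_j) ∈ ℓ² with c_j ≠ 0 for all j. Then V extends to a bounded operator that is not injective, yet for every finite Λ ⊂ ℕ the restriction of V to ℓ²(Λ) is injective (i.e., V has the finite basis injectivity property). -/

import Mathlib

open scoped ENNReal

lemma shift_mem (x : lp (fun _ : ℕ+ => ℂ) 2) :
    Memℓp (fun j : ℕ+ => x (j + 1)) 2 := by
  have h2 : 0 < (2 : ℝ≥0∞).toReal := by norm_num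
  have := (memℓp_gen_iff h2).1 (lp.memℓp x)
  exact (memℓp_gen_iff h2).2 (this.comp_injective (add_left_injective (1 : ℕ+)))

noncomputable def shiftL : lp (fun _ : ℕ+ => ℂ) 2 →ₗ[ℂ] lp (fun _ : ℕ+ => ℂ) 2 where
  toFun x := ⟨fun j : ℕ+ => x (j + 1), shift_mem x⟩
  map_add' x y := by
    ext j
    rfl
  map_smul' a x := by
    ext j
    rfl

lemma shiftL_apply (x : lp (fun _ : ℕ+ => ℂ) 2) (j : ℕ+) : shiftL x j = x (j + 1) := rfl

lemma shiftL_bound (x : lp (fun _ : ℕ+ => ℂ) 2) : ‖shiftL x‖ ≤ 1 * ‖x‖ := by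
  have h2 : 0 < (2 : ℝ≥0∞).toReal := by norm_num
  rw [one_mul]
  refine lp.norm_le_of_forall_sum_le h2 (norm_nonneg _) fun s => ?_
  have := lp.sum_rpow_le_norm_rpow h2 x (s.map ⟨_, add_left_injective (1 : ℕ+)⟩)
  rw [Finset.sum_map] at this
  exact this

lemma ker_mem (c : ℕ+ → ℂ) (hc2 : Memℓp c 2) :
    Memℓp (fun n : ℕ+ => if n = 1 then (0 : ℂ) else -c (n - 1)) 2 := by
  have h2 : 0 < (2 : ℝ≥0∞).toReal := by norm_num
  refine (memℓp_gen_iff h2).2 ?_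
  rw [← (add_left_injective (1 : ℕ+)).summable_iff]
  · refine ((memℓp_gen_iff h2).1 hc2).congr fun j => ?_
    have : j + 1 ≠ 1 := by
      intro h
      have := congrArg PNat.val h
      simp at this
    simp [this]
  · intro n hn
    have : n = 1 := by
      by_contra h
      obtain ⟨k, rfl⟩ := PNat.exists_eq_succ_of_ne_one h
      exact hn ⟨k, rfl⟩
    simp [this]

/-- A non-injective operator with the finite basis injectivity property: given
`(c_j) ∈ ℓ²` with all `c_j ≠ 0`, the bounded operator `V : ℓ²(ℕ₊) → ℓ²(ℕ₊)` with
`V e₁ = ∑ⱼ c_j e_j` and `V e_i = e_{i−1}` for `i ≥ 2` is not injective, yet its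
restriction to `ℓ²(Λ)` is injective for every finite `Λ`. -/
theorem stmt16 (c : ℕ+ → ℂ) (hc2 : Memℓp c 2) (hcne : ∀ j, c j ≠ 0) :
    ∃ V : lp (fun _ : ℕ+ => ℂ) 2 →L[ℂ] lp (fun _ : ℕ+ => ℂ) 2,
      (∀ j : ℕ+, (V (lp.single 2 (1 : ℕ+) (1 : ℂ))) j = c j) ∧
      (∀ i : ℕ+, 2 ≤ i → V (lp.single 2 i (1 : ℂ)) = lp.single 2 (i - 1) (1 : ℂ)) ∧
      ¬ Function.Injective V ∧
      (∀ (Λ : Finset ℕ+) (x : lp (fun _ : ℕ+ => ℂ) 2),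
        (∀ i, i ∉ Λ → x i = 0) → V x = 0 → x = 0) := by
  have hs : ∀ j : ℕ+, j + 1 ≠ 1 := by
    intro j h
    have := congrArg PNat.val h
    simp at this
  let C : lp (fun _ : ℕ+ => ℂ) 2 := ⟨c, hc2⟩
  let V : lp (fun _ : ℕ+ => ℂ) 2 →L[ℂ] lp (fun _ : ℕ+ => ℂ) 2 :=
    shiftL.mkContinuous 1 shiftL_bound +
      (innerSL ℂ (lp.single 2 (1 : ℕ+) (1 : ℂ) : lp (fun _ : ℕ+ => ℂ) 2)).smulRight C
  have hV : ∀ x j, V x j = x (j + 1) + x 1 * c j := by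
    intro x j
    have h1 : V x = shiftL x +
      (inner ℂ (lp.single 2 (1 : ℕ+) (1 : ℂ) : lp (fun _ : ℕ+ => ℂ) 2) x) • C := rfl
    rw [h1, lp.inner_single_left]
    simp [C]
    rfl
  refine ⟨V, ?_, ?_, ?_, ?_⟩
  · intro j
    rw [hV]
    simp [lp.single_apply, Pi.single_apply, hs]
  · intro i hi
    obtain ⟨k, rfl⟩ := PNat.exists_eq_succ_of_ne_one (n := i) (by rintro rfl; exact absurd hi (by decide))
    ext j
    rw [hV]
    simp [lp.single_apply, Pi.single_apply, (hs k).symm]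
  · intro hinj
    let w : lp (fun _ : ℕ+ => ℂ) 2 := lp.single 2 (1 : ℕ+) (1 : ℂ) + ⟨_, ker_mem c hc2⟩
    have hw : ∀ n, w n = (if n = 1 then (1 : ℂ) else 0) + (if n = 1 then (0 : ℂ) else -c (n - 1)) := by
      intro n
      have e : w n = (lp.single 2 (1 : ℕ+) (1 : ℂ) : lp (fun _ : ℕ+ => ℂ) 2) n +
        (if n = 1 then (0 : ℂ) else -c (n - 1)) := rfl
      rw [e]
      simp [lp.single_apply, Pi.single_apply]
    have h0 : V w = V 0 := by
      rw [map_zero]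
      ext j
      rw [hV, hw, hw]
      simp [hs]
    have h1 := hw 1
    rw [hinj h0] at h1
    simp at h1
  · intro Λ x hx h
    have hj : ∀ j, x (j + 1) + x 1 * c j = 0 := by
      intro j
      rw [← hV, h]
      rfl
    obtain ⟨n, hn⟩ := Infinite.exists_notMem_finset (insert 1 Λ)
    simp only [Finset.mem_insert, not_or] at hn
    obtain ⟨k, rfl⟩ := PNat.exists_eq_succ_of_ne_one hn.1
    have h1 : x 1 = 0 := by
      have := hj k
      rw [hx _ hn.2, zero_add] at this
      exact (mul_eq_zero.1 this).resolve_right (hcne k)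
    ext i
    by_cases hi : i = 1
    · rw [hi, h1]
      rfl
    · obtain ⟨m, rfl⟩ := PNat.exists_eq_succ_of_ne_one hi
      have := hj m
      rw [h1, zero_mul, add_zero] at this
      rw [this]
      rfl
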